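/- Suppose the limit L = lim_{n→∞} (M_n)^{1/n} exists. Then liminf_{n→∞} (M^{Irr}_n)^{1/n} ≥ √L. -/

import Mathlib

open Filter

/-- `x` lies strictly between `p` and `q`. -/
def StrictlyBetween (p q x : ℕ) : Prop := min p q < x ∧ x < max p q

/-- Two arcs `{p, q}` and `{r, s}` cross if exactly one of `r`, `s` lies strictly
between `p` and `q`. -/
def ArcsCross (p q r s : ℕ) : Prop :=
  Xor' (StrictlyBetween p q r) (StrictlyBetween p q s)

/-- `a` (with one-based indexing, only the values `a 1, …, a n` being relevant)
is an open meandric permutation of order `n`: it is a permutation of `{1, …, n}`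
with `a i ≡ i (mod 2)`, whose upper arcs (pairs `{a i, a (i+1)}` for odd `i < n`)
are pairwise noncrossing, whose lower arcs (pairs `{a i, a (i+1)}` for even
`1 ≤ i < n`) are pairwise noncrossing, such that no lower arc strictly encloses
`a 1`, and no lower arc (if `n` is even) resp. upper arc (if `n` is odd)
strictly encloses `a n`. -/
def IsOpenMeandricPerm (n : ℕ) (a : ℕ → ℕ) : Prop :=
  1 ≤ n ∧
  (∀ i, 1 ≤ i → i ≤ n → 1 ≤ a i ∧ a i ≤ n) ∧
  (∀ i j, 1 ≤ i → i ≤ n → 1 ≤ j → j ≤ n → a i = a j → i = j) ∧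
  (∀ i, 1 ≤ i → i ≤ n → a i % 2 = i % 2) ∧
  (∀ i j, Odd i → i < n → Odd j → j < n →
      ¬ ArcsCross (a i) (a (i + 1)) (a j) (a (j + 1))) ∧
  (∀ i j, Even i → 1 ≤ i → i < n → Even j → 1 ≤ j → j < n →
      ¬ ArcsCross (a i) (a (i + 1)) (a j) (a (j + 1))) ∧
  (∀ i, Even i → 1 ≤ i → i < n → ¬ StrictlyBetween (a i) (a (i + 1)) (a 1)) ∧
  (if Even n
    then ∀ i, Even i → 1 ≤ i → i < n → ¬ StrictlyBetween (a i) (a (i + 1)) (a n)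
    else ∀ i, Odd i → i < n → ¬ StrictlyBetween (a i) (a (i + 1)) (a n))

/-- An open meandric permutation of order `n` is irreducible if there are no
indices `1 ≤ k₁ < k₂ ≤ n` with `2 < k₂ - k₁ ≤ n - 2` such that the values
`a k₁, …, a k₂` form an interval of integers, i.e. their max minus their min
equals `k₂ - k₁`. -/
def IsIrreducibleMeander (n : ℕ) (a : ℕ → ℕ) : Prop :=
  ¬ ∃ k₁ k₂ : ℕ, ∃ h : k₁ < k₂, 1 ≤ k₁ ∧ k₂ ≤ n ∧ 2 < k₂ - k₁ ∧ k₂ - k₁ ≤ n - 2 ∧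
    (Finset.Icc k₁ k₂).sup' (Finset.nonempty_Icc.mpr h.le) a -
      (Finset.Icc k₁ k₂).inf' (Finset.nonempty_Icc.mpr h.le) a = k₂ - k₁

/-- An open meandric permutation of order `n` is prime if `a 1 ≠ 1` and no proper
initial segment `a 1, …, a j` (`2 ≤ j < n`) is a permutation of `{1, …, j}`. -/
def IsPrimeMeander (n : ℕ) (a : ℕ → ℕ) : Prop :=
  a 1 ≠ 1 ∧ ¬ ∃ j, 2 ≤ j ∧ j < n ∧ (Finset.Icc 1 j).image a = Finset.Icc 1 j

/-- `a` (with one-based indexing) is a closed meandric permutation of order `n`: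
a permutation of `{1, …, 2n}` with `a 1 = 1`, `a i ≡ i (mod 2)`, pairwise
noncrossing upper arcs `{a i, a (i+1)}` (odd `i < 2n`) and pairwise noncrossing
lower arcs, the latter being the `{a i, a (i+1)}` for even `1 ≤ i < 2n` together
with the wrap-around arc `{a (2n), a 1}`. -/
def IsClosedMeandricPerm (n : ℕ) (a : ℕ → ℕ) : Prop :=
  1 ≤ n ∧ a 1 = 1 ∧
  (∀ i, 1 ≤ i → i ≤ 2 * n → 1 ≤ a i ∧ a i ≤ 2 * n) ∧
  (∀ i j, 1 ≤ i → i ≤ 2 * n → 1 ≤ j → j ≤ 2 * n → a i = a j → i = j) ∧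
  (∀ i, 1 ≤ i → i ≤ 2 * n → a i % 2 = i % 2) ∧
  (∀ i j, Odd i → i < 2 * n → Odd j → j < 2 * n →
      ¬ ArcsCross (a i) (a (i + 1)) (a j) (a (j + 1))) ∧
  (∀ i j, Even i → 1 ≤ i → i < 2 * n → Even j → 1 ≤ j → j < 2 * n →
      ¬ ArcsCross (a i) (a (i + 1)) (a j) (a (j + 1))) ∧
  (∀ i, Even i → 1 ≤ i → i < 2 * n →
      ¬ ArcsCross (a i) (a (i + 1)) (a (2 * n)) (a 1) ∧
      ¬ ArcsCross (a (2 * n)) (a 1) (a i) (a (i + 1)))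

/-- `M n`: the number of open meandric permutations of order `n` (each counted
once via the normalization `a i = 0` outside `{1, …, n}`). -/
noncomputable def openMeanderCount (n : ℕ) : ℕ :=
  Set.ncard {a : ℕ → ℕ | IsOpenMeandricPerm n a ∧ ∀ i, i < 1 ∨ n < i → a i = 0}

/-- `M^{Irr} n`: the number of irreducible open meandric permutations of order `n`. -/
noncomputable def irrMeanderCount (n : ℕ) : ℕ :=
  Set.ncard {a : ℕ → ℕ | IsOpenMeandricPerm n a ∧ IsIrreducibleMeander n a ∧
    ∀ i, i < 1 ∨ n < i → a i = 0}

/-- `M^{(P)} n`: the number of prime open meandric permutations of order `n`. -/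
noncomputable def primeMeanderCount (n : ℕ) : ℕ :=
  Set.ncard {a : ℕ → ℕ | IsOpenMeandricPerm n a ∧ IsPrimeMeander n a ∧
    ∀ i, i < 1 ∨ n < i → a i = 0}

/-- `M̄ n`: the number of closed meandric permutations of order `n`. -/
noncomputable def closedMeanderCount (n : ℕ) : ℕ :=
  Set.ncard {a : ℕ → ℕ | IsClosedMeandricPerm n a ∧ ∀ i, i < 1 ∨ 2 * n < i → a i = 0}

theorem isOpenMeandricPerm_iff {n : ℕ} {a : ℕ → ℕ} :
    IsOpenMeandricPerm n a ↔
      1 ≤ n ∧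
      (∀ t ≤ n, 1 ≤ t → 1 ≤ a t ∧ a t ≤ n ∧ a t % 2 = t % 2) ∧
      (∀ s ≤ n, ∀ t ≤ n, 1 ≤ s → 1 ≤ t → a s = a t → s = t) ∧
      (∀ s < n, ∀ t < n, 1 ≤ s → 1 ≤ t → s % 2 = t % 2 →
        ¬ ArcsCross (a s) (a (s + 1)) (a t) (a (t + 1))) ∧
      (∀ t < n, 1 ≤ t → t % 2 = 0 → ¬ StrictlyBetween (a t) (a (t + 1)) (a 1)) ∧
      (∀ t < n, 1 ≤ t → t % 2 = n % 2 → ¬ StrictlyBetween (a t) (a (t + 1)) (a n)) := by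
  constructor
  · rintro ⟨h1, hb, hi, hp, hu, hl, hs, he⟩
    refine ⟨h1, fun t h h' => ⟨(hb t h' h).1, (hb t h' h).2, hp t h' h⟩,
      fun s h t h' k k' => hi s t k h k' h', ?_, ?_, ?_⟩
    · intro s hs' t ht h1s h1t hst
      rcases Nat.even_or_odd s with e | o
      · exact hl s t e h1s hs' (Nat.even_iff.2 (hst ▸ Nat.even_iff.1 e)) h1t ht
      · exact hu s t o hs' (Nat.odd_iff.2 (hst ▸ Nat.odd_iff.1 o)) ht
    · exact fun t ht h1t h => hs t (Nat.even_iff.2 h) h1t ht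
    · intro t ht h1t h
      split_ifs at he with hn
      · exact he t (Nat.even_iff.2 (h.trans (Nat.even_iff.1 hn))) h1t ht
      · exact he t (Nat.odd_iff.2 (h.trans (Nat.odd_iff.1 (Nat.not_even_iff_odd.1 hn)))) ht
  · rintro ⟨h1, hb, hi, hc, hs, he⟩
    refine ⟨h1, fun t h h' => ⟨(hb t h' h).1, (hb t h' h).2.1⟩,
      fun s t k h k' h' => hi s h t h' k k', fun t h h' => (hb t h' h).2.2, ?_, ?_, ?_, ?_⟩
    · intro s t os hs' ot ht
      exact hc s hs' t ht os.pos ot.pos ((Nat.odd_iff.1 os).trans (Nat.odd_iff.1 ot).symm)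
    · intro s t es h1s hs' et h1t ht
      exact hc s hs' t ht h1s h1t ((Nat.even_iff.1 es).trans (Nat.even_iff.1 et).symm)
    · exact fun t et h1t ht => hs t ht h1t (Nat.even_iff.1 et)
    · split_ifs with hn
      · exact fun t et h1t ht =>
          he t ht h1t ((Nat.even_iff.1 et).trans (Nat.even_iff.1 hn).symm)
      · exact fun t ot ht => he t ht ot.pos
          ((Nat.odd_iff.1 ot).trans (Nat.odd_iff.1 (Nat.not_even_iff_odd.1 hn)).symm)

theorem strictlyBetween_comm {p q x : ℕ} : StrictlyBetween p q x ↔ StrictlyBetween q p x := by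
  unfold StrictlyBetween; rw [min_comm, max_comm]

theorem arcsCross_iff_not_iff {p q r s : ℕ} :
    ArcsCross p q r s ↔ ¬ (StrictlyBetween p q r ↔ StrictlyBetween p q s) := by
  unfold ArcsCross
  exact xor_iff_not_iff _ _

theorem arcsCross_swap_left {p q r s : ℕ} : ArcsCross p q r s ↔ ArcsCross q p r s := by
  unfold ArcsCross
  rw [strictlyBetween_comm (x := r), strictlyBetween_comm (x := s)]

theorem arcsCross_swap_right {p q r s : ℕ} : ArcsCross p q r s ↔ ArcsCross p q s r := by
  rw [arcsCross_iff_not_iff, arcsCross_iff_not_iff]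
  exact not_congr ⟨Iff.symm, Iff.symm⟩

theorem strictlyBetween_double_iff {w x y z d d' d'' : ℕ} (hd : d ≤ 1) (hd' : d' ≤ 1)
    (hd'' : d'' ≤ 1) (hx : 1 ≤ x) (hy : 1 ≤ y) (hz : 1 ≤ z) (hxz : x ≠ z) (hyz : y ≠ z) :
    StrictlyBetween (w + 2 * x - d) (w + 2 * y - d') (w + 2 * z - d'') ↔
      StrictlyBetween x y z := by
  unfold StrictlyBetween
  omega

theorem StrictMono.strictlyBetween_iff {f : ℕ → ℕ} (hf : StrictMono f) {p q x : ℕ} :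
    StrictlyBetween (f p) (f q) (f x) ↔ StrictlyBetween p q x := by
  unfold StrictlyBetween
  rw [← hf.monotone.map_min, ← hf.monotone.map_max, hf.lt_iff_lt, hf.lt_iff_lt]

theorem StrictMono.arcsCross_iff {f : ℕ → ℕ} (hf : StrictMono f) {p q r s : ℕ} :
    ArcsCross (f p) (f q) (f r) (f s) ↔ ArcsCross p q r s := by
  unfold ArcsCross
  rw [hf.strictlyBetween_iff, hf.strictlyBetween_iff]

/-- A permutation is irreducible as soon as the value set of every relevant segment fails to be
convex. -/
theorem isIrreducibleMeander_of_not_convex {n : ℕ} {a : ℕ → ℕ} (ha : IsOpenMeandricPerm n a)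
    (h : ∀ k₁ k₂, 1 ≤ k₁ → k₂ ≤ n → 2 < k₂ - k₁ → k₂ - k₁ ≤ n - 2 →
      ¬ ∀ s t u, 1 ≤ s → s ≤ n → (s < k₁ ∨ k₂ < s) → k₁ ≤ t → t ≤ k₂ → k₁ ≤ u → u ≤ k₂ →
        ¬ (a t < a s ∧ a s < a u)) :
    IsIrreducibleMeander n a := by
  rintro ⟨k₁, k₂, hlt, h1, hn, hlo, hhi, heq⟩
  obtain ⟨-, -, hinj, -⟩ := isOpenMeandricPerm_iff.1 ha
  refine h k₁ k₂ h1 hn hlo hhi fun s t u hs hsn hout ht ht' hu hu' ⟨hts, hsu⟩ => ?_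
  have hne : (Finset.Icc k₁ k₂).Nonempty := Finset.nonempty_Icc.mpr hlt.le
  set M := (Finset.Icc k₁ k₂).sup' hne a
  set m := (Finset.Icc k₁ k₂).inf' hne a
  have hsub : (Finset.Icc k₁ k₂).image a ⊆ Finset.Icc m M := by
    intro x hx
    obtain ⟨y, hy, rfl⟩ := Finset.mem_image.1 hx
    exact Finset.mem_Icc.2 ⟨Finset.inf'_le _ hy, Finset.le_sup' _ hy⟩
  have hcard : ((Finset.Icc k₁ k₂).image a).card = k₂ + 1 - k₁ := by
    rw [Finset.card_image_of_injOn, Nat.card_Icc]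
    intro x hx y hy hxy
    simp only [Finset.coe_Icc, Set.mem_Icc] at hx hy
    exact hinj x (by omega) y (by omega) (by omega) (by omega) hxy
  have him : (Finset.Icc k₁ k₂).image a = Finset.Icc m M := by
    refine Finset.eq_of_subset_of_card_le hsub ?_
    rw [hcard, Nat.card_Icc]
    omega
  have hmem : a s ∈ (Finset.Icc k₁ k₂).image a := by
    rw [him, Finset.mem_Icc]
    have h₁ : m ≤ a t := Finset.inf'_le _ (Finset.mem_Icc.2 ⟨ht, ht'⟩)
    have h₂ : a u ≤ M := Finset.le_sup' _ (Finset.mem_Icc.2 ⟨hu, hu'⟩)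
    omega
  obtain ⟨y, hy, hys⟩ := Finset.mem_image.1 hmem
  rw [Finset.mem_Icc] at hy
  have := hinj y (by omega) s hsn (by omega) hs hys
  omega

/-- An open meandric permutation `p` of order `r` whose points at the indices `1` and `j` carry
the adjacent values `w + 1` and `w + 2`, which are separated by both smaller and larger values, and
in which no proper segment of length at least three has a convex value set. -/
structure IsDoublingSeed (r w j : ℕ) (p : ℕ → ℕ) : Prop where
  perm : IsOpenMeandricPerm r p
  w_even : w % 2 = 0
  j_even : j % 2 = 0
  j_le : j ≤ r
  first : p 1 = w + 1
  second : p j = w + 2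
  low : ∃ s < j, 1 < s ∧ p s ≤ w
  high : ∃ s < j, 1 < s ∧ w + 3 ≤ p s
  simple : ∀ k₁ ≤ r, ∀ k₂ ≤ r, 1 ≤ k₁ → k₁ + 2 ≤ k₂ → k₂ + 2 ≤ r + k₁ →
    ∃ s ≤ r, 1 ≤ s ∧ (s < k₁ ∨ k₂ < s) ∧ (∃ t ≤ k₂, k₁ ≤ t ∧ p t < p s) ∧
      ∃ u ≤ k₂, k₁ ≤ u ∧ p s < p u

/-- Replace the points of `p` at the indices `1` and `j`, with values `w + 1` and `w + 2`, by two
parallel copies of the permutation `a` of order `n`, traversed in opposite directions. -/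
def doubleInto (r w j n : ℕ) (p a : ℕ → ℕ) (t : ℕ) : ℕ :=
  if t = 0 ∨ r + 2 * n - 2 < t then 0
  else if t ≤ n then w + 2 * a t - t % 2
  else if t + 1 < n + j then
    if p (t + 1 - n) ≤ w then p (t + 1 - n) else p (t + 1 - n) + 2 * n - 2
  else if t + 1 < 2 * n + j then w + 2 * a (2 * n + j - 1 - t) - (2 * n + j - t) % 2
  else if p (t + 2 - 2 * n) ≤ w then p (t + 2 - 2 * n) else p (t + 2 - 2 * n) + 2 * n - 2

/-- The order embedding of the values of the seed which places `w + 1` and `w + 2` at the two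
copies of the value `e` of the inserted permutation. -/
def seedEmb (w n e x : ℕ) : ℕ :=
  if x ≤ w then x else if x ≤ w + 2 then x + 2 * e - 2 else x + 2 * n - 2

theorem seedEmb_strictMono {w n e : ℕ} (he : 1 ≤ e) (hen : e ≤ n) :
    StrictMono (seedEmb w n e) := by
  intro x y hxy
  unfold seedEmb
  split_ifs <;> omega

namespace IsDoublingSeed

variable {r w j n : ℕ} {p a : ℕ → ℕ}

theorem four_le (hp : IsDoublingSeed r w j p) : 4 ≤ j := by
  obtain ⟨s, hs, hs1, hsw⟩ := hp.low
  have := hp.j_even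
  omega

theorem old_value (hp : IsDoublingSeed r w j p) {s : ℕ} (h1 : 1 < s) (hr : s ≤ r) (hj : s ≠ j) :
    1 ≤ p s ∧ p s ≤ r ∧ p s % 2 = s % 2 ∧ p s ≠ w + 1 ∧ p s ≠ w + 2 := by
  obtain ⟨-, hb, hi, -⟩ := isOpenMeandricPerm_iff.1 hp.perm
  have hj' := hp.j_le
  have hj4 := hp.four_le
  obtain ⟨b1, b2, b3⟩ := hb s hr (by omega)
  refine ⟨b1, b2, b3, fun h => ?_, fun h => ?_⟩
  · have := hi s hr 1 (by omega) (by omega) le_rfl (h.trans hp.first.symm)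
    omega
  · exact hj (hi s hr j hj' (by omega) (by omega) (h.trans hp.second.symm))

theorem w_add_two_le (hp : IsDoublingSeed r w j p) : w + 2 ≤ r := by
  obtain ⟨-, hb, -⟩ := isOpenMeandricPerm_iff.1 hp.perm
  have := hb j hp.j_le (by have := hp.four_le; omega)
  rw [hp.second] at this
  omega

theorem doubleInto_left {t : ℕ} (h1 : 1 ≤ t) (h2 : t ≤ n) (hr : 2 ≤ r) :
    doubleInto r w j n p a t = w + 2 * a t - t % 2 := by
  unfold doubleInto
  rw [if_neg (by omega), if_pos h2]

theorem doubleInto_right (hp : IsDoublingSeed r w j p) {k : ℕ} (h1 : 1 ≤ k) (h2 : k ≤ n) :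
    doubleInto r w j n p a (2 * n + j - 1 - k) = w + 2 * a k - (k + 1) % 2 := by
  have := hp.four_le
  have := hp.j_le
  unfold doubleInto
  rw [if_neg (by omega), if_neg (by omega), if_neg (by omega), if_pos (by omega)]
  rw [show 2 * n + j - 1 - (2 * n + j - 1 - k) = k by omega,
    show 2 * n + j - (2 * n + j - 1 - k) = k + 1 by omega]

/-- The index at which the old point with index `s` is found after doubling. -/
def oldIndex (j n s : ℕ) : ℕ := if s < j then s + n - 1 else s + 2 * n - 2

theorem doubleInto_oldIndex (hp : IsDoublingSeed r w j p) (hn : 1 ≤ n) {s : ℕ} (h1 : 1 < s)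
    (hr : s ≤ r) (hj : s ≠ j) (e : ℕ) :
    doubleInto r w j n p a (oldIndex j n s) = seedEmb w n e (p s) := by
  have := hp.four_le
  have := hp.j_le
  have hv := hp.old_value h1 hr hj
  unfold doubleInto oldIndex seedEmb
  by_cases hsj : s < j
  · rw [if_pos hsj, if_neg (by omega), if_neg (by omega), if_pos (by omega),
      show s + n - 1 + 1 - n = s by omega]
    split_ifs <;> omega
  · rw [if_neg hsj, if_neg (by omega), if_neg (by omega), if_neg (by omega), if_neg (by omega),
      show s + 2 * n - 2 + 2 - 2 * n = s by omega]
    split_ifs <;> omega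

theorem index_cases (hp : IsDoublingSeed r w j p) (hn : 1 ≤ n) {t : ℕ} (h1 : 1 ≤ t)
    (ht : t ≤ r + 2 * n - 2) :
    (1 ≤ t ∧ t ≤ n) ∨ (∃ k, 1 ≤ k ∧ k ≤ n ∧ t = 2 * n + j - 1 - k) ∨
      ∃ s, 1 < s ∧ s ≤ r ∧ s ≠ j ∧ t = oldIndex j n s := by
  have := hp.four_le
  have := hp.j_le
  unfold oldIndex
  by_cases c1 : t ≤ n
  · exact Or.inl ⟨h1, c1⟩
  by_cases c2 : t + 1 < n + j
  · exact Or.inr (Or.inr ⟨t + 1 - n, by omega, by omega, by omega, by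
      rw [if_pos (by omega)]; omega⟩)
  by_cases c3 : t + 1 < 2 * n + j
  · exact Or.inr (Or.inl ⟨2 * n + j - 1 - t, by omega, by omega, by omega⟩)
  · exact Or.inr (Or.inr ⟨t + 2 - 2 * n, by omega, by omega, by omega, by
      rw [if_neg (by omega)]; omega⟩)

/-- The value of the inserted permutation next to the ends of the arcs with index `t` that lead
into the two copies. -/
def endValue (n : ℕ) (a : ℕ → ℕ) (t : ℕ) : ℕ := if t % 2 = 1 then a n else a 1

theorem doubleInto_first (hp : IsDoublingSeed r w j p) (hn : 1 ≤ n) (ha : 1 ≤ a 1) :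
    doubleInto r w j n p a 1 = seedEmb w n (a 1) (p 1) := by
  have := hp.w_add_two_le
  rw [doubleInto_left le_rfl hn (by omega), hp.first]
  unfold seedEmb
  rw [if_neg (by omega), if_pos (by omega)]
  omega

theorem doubleInto_last (hp : IsDoublingSeed r w j p) (hn : n % 2 = 1) (ha : 1 ≤ a 1) :
    doubleInto r w j n p a (r + 2 * n - 2) = seedEmb w n (endValue n a r) (p r) := by
  have := hp.four_le
  have := hp.j_le
  have hje := hp.j_even
  by_cases hj : r = j
  · subst hj
    rw [show r + 2 * n - 2 = 2 * n + r - 1 - 1 by omega, hp.doubleInto_right le_rfl (by omega),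
      hp.second]
    unfold seedEmb endValue
    rw [if_neg (by omega), if_pos (by omega), if_neg (by omega)]
    omega
  · rw [← hp.doubleInto_oldIndex (by omega) (by omega) le_rfl hj, oldIndex, if_neg (by omega)]

theorem arc_cases (hp : IsDoublingSeed r w j p) (hn : n % 2 = 1)
    (ha : ∀ t ≤ n, 1 ≤ t → 1 ≤ a t) {t : ℕ} (h1 : 1 ≤ t) (ht : t < r + 2 * n - 2) :
    (∃ s < r, 1 ≤ s ∧ s % 2 = t % 2 ∧
      doubleInto r w j n p a t = seedEmb w n (endValue n a t) (p s) ∧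
      doubleInto r w j n p a (t + 1) = seedEmb w n (endValue n a t) (p (s + 1))) ∨
    ∃ k < n, ∃ d ≤ 1, 1 ≤ k ∧ k % 2 = t % 2 ∧
      ((doubleInto r w j n p a t = w + 2 * a k - d ∧
        doubleInto r w j n p a (t + 1) = w + 2 * a (k + 1) - (1 - d)) ∨
       (doubleInto r w j n p a (t + 1) = w + 2 * a k - d ∧
        doubleInto r w j n p a t = w + 2 * a (k + 1) - (1 - d))) := by
  have h4 := hp.four_le
  have hjr := hp.j_le
  have hje := hp.j_even
  have han := ha n le_rfl (by omega)
  have ha1 := ha 1 (by omega) le_rfl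
  have hn1 : 1 ≤ n := by omega
  by_cases c1 : t < n
  · right
    refine ⟨t, c1, t % 2, by omega, h1, rfl, Or.inl ⟨doubleInto_left h1 c1.le (by omega), ?_⟩⟩
    rw [doubleInto_left (by omega) (by omega) (by omega)]
    omega
  by_cases c2 : t = n
  · left
    subst c2
    refine ⟨1, by omega, le_rfl, by omega, ?_, ?_⟩
    · rw [doubleInto_left h1 le_rfl (by omega), hp.first]
      unfold seedEmb endValue
      rw [if_neg (by omega), if_pos (by omega), if_pos (by omega)]
      omega
    · rw [← hp.doubleInto_oldIndex (a := a) hn1 (by omega) (by omega) (by omega), oldIndex,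
        if_pos (by omega)]
      congr 1
      omega
  by_cases c3 : t + 2 < n + j
  · left
    refine ⟨t + 1 - n, by omega, by omega, by omega, ?_, ?_⟩
    · rw [← hp.doubleInto_oldIndex (a := a) hn1 (by omega) (by omega) (by omega), oldIndex,
        if_pos (by omega)]
      congr 1
      omega
    · rw [← hp.doubleInto_oldIndex (a := a) hn1 (by omega) (by omega) (by omega), oldIndex,
        if_pos (by omega)]
      congr 1
      omega
  by_cases c4 : t + 2 = n + j
  · left
    refine ⟨j - 1, by omega, by omega, by omega, ?_, ?_⟩
    · rw [← hp.doubleInto_oldIndex (a := a) hn1 (by omega) (by omega) (by omega), oldIndex,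
        if_pos (by omega)]
      congr 1
      omega
    · rw [show j - 1 + 1 = j by omega, hp.second, show t + 1 = 2 * n + j - 1 - n by omega,
        hp.doubleInto_right hn1 le_rfl]
      unfold seedEmb endValue
      rw [if_neg (by omega), if_pos (by omega), if_pos (by omega)]
      omega
  by_cases c5 : t + 2 < 2 * n + j
  · right
    refine ⟨2 * n + j - 2 - t, by omega, (2 * n + j - 2 - t + 1) % 2, by omega, by omega, by omega,
      Or.inr ⟨?_, ?_⟩⟩
    · rw [← hp.doubleInto_right (n := n) (k := 2 * n + j - 2 - t) (by omega) (by omega)]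
      congr 1
      omega
    · have := hp.doubleInto_right (a := a) (n := n) (k := 2 * n + j - 2 - t + 1) (by omega)
        (by omega)
      rw [show 2 * n + j - 1 - (2 * n + j - 2 - t + 1) = t by omega] at this
      rw [this]
      omega
  by_cases c6 : t + 2 = 2 * n + j
  · left
    refine ⟨j, by omega, by omega, by omega, ?_, ?_⟩
    · rw [show t = 2 * n + j - 1 - 1 by omega, hp.doubleInto_right le_rfl hn1, hp.second]
      unfold seedEmb endValue
      rw [if_neg (by omega), if_pos (by omega), if_neg (by omega)]
      omega
    · rw [← hp.doubleInto_oldIndex (a := a) hn1 (by omega) (by omega) (by omega), oldIndex,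
        if_neg (by omega)]
      congr 1
      omega
  · left
    refine ⟨t + 2 - 2 * n, by omega, by omega, by omega, ?_, ?_⟩
    · rw [← hp.doubleInto_oldIndex (a := a) hn1 (by omega) (by omega) (by omega), oldIndex,
        if_neg (by omega)]
      congr 1
      omega
    · rw [← hp.doubleInto_oldIndex (a := a) hn1 (by omega) (by omega) (by omega), oldIndex,
        if_neg (by omega)]
      congr 1
      omega

theorem endValue_mem (hn : n % 2 = 1) (ha : IsOpenMeandricPerm n a) (t : ℕ) :
    1 ≤ endValue n a t ∧ endValue n a t ≤ n := by
  obtain ⟨h1, hb, -⟩ := isOpenMeandricPerm_iff.1 ha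
  have := hb n le_rfl h1
  have := hb 1 h1 le_rfl
  unfold endValue
  split_ifs <;> omega

/-- An arc inside one of the two copies lies on one side of every point of the embedded seed. -/
theorem copy_arc_sep (hn : n % 2 = 1) (ha : IsOpenMeandricPerm n a) {k d t : ℕ} (hk : k < n)
    (h1 : 1 ≤ k) (hd : d ≤ 1) (hkt : k % 2 = t % 2) (x : ℕ) :
    (w + 2 * a k - d < seedEmb w n (endValue n a t) x ∧
      w + 2 * a (k + 1) - (1 - d) < seedEmb w n (endValue n a t) x) ∨
    (seedEmb w n (endValue n a t) x < w + 2 * a k - d ∧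
      seedEmb w n (endValue n a t) x < w + 2 * a (k + 1) - (1 - d)) := by
  have hmem := endValue_mem hn ha t
  obtain ⟨-, hb, hi, -, hs, he⟩ := isOpenMeandricPerm_iff.1 ha
  have hb1 := hb k hk.le h1
  have hb2 := hb (k + 1) hk (by omega)
  have key : (a k < endValue n a t ∧ a (k + 1) < endValue n a t) ∨
      (endValue n a t < a k ∧ endValue n a t < a (k + 1)) := by
    unfold endValue
    split_ifs with ht
    · have h := he k hk h1 (by omega)
      have n1 : a k ≠ a n := fun h => by
        have := hi k hk.le n le_rfl h1 (by omega) h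
        omega
      have n2 : a (k + 1) ≠ a n := fun h => by
        have := hi (k + 1) hk n le_rfl (by omega) (by omega) h
        omega
      unfold StrictlyBetween at h
      omega
    · have h := hs k hk h1 (by omega)
      have n1 : a k ≠ a 1 := fun h => by
        have := hi k hk.le 1 (by omega) h1 (by omega) h
        omega
      have n2 : a (k + 1) ≠ a 1 := fun h => by
        have := hi (k + 1) hk 1 (by omega) (by omega) (by omega) h
        omega
      unfold StrictlyBetween at h
      omega
  unfold seedEmb
  split_ifs <;> omega

theorem copy_arcs_not_cross (ha : IsOpenMeandricPerm n a) {k l d d' : ℕ} (hk : k < n)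
    (hl : l < n) (h1 : 1 ≤ k) (h1' : 1 ≤ l) (hd : d ≤ 1) (hd' : d' ≤ 1) (hkl : k % 2 = l % 2) :
    ¬ ArcsCross (w + 2 * a k - d) (w + 2 * a (k + 1) - (1 - d))
      (w + 2 * a l - d') (w + 2 * a (l + 1) - (1 - d')) := by
  obtain ⟨-, hb, hi, hc, -⟩ := isOpenMeandricPerm_iff.1 ha
  have b1 := hb k hk.le h1
  have b2 := hb (k + 1) hk (by omega)
  have b3 := hb l hl.le h1'
  have b4 := hb (l + 1) hl (by omega)
  have hne : a k ≠ a (k + 1) := fun h => by omega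
  by_cases e : k = l
  · subst e
    rw [arcsCross_iff_not_iff]
    unfold StrictlyBetween
    omega
  · have n1 : a k ≠ a l := fun h => e (hi k hk.le l hl.le h1 h1' h)
    have n2 : a (k + 1) ≠ a (l + 1) := fun h => by
      have := hi (k + 1) hk (l + 1) hl (by omega) (by omega) h
      omega
    have n3 : a k ≠ a (l + 1) := fun h => by omega
    have n4 : a (k + 1) ≠ a l := fun h => by omega
    have h := hc k hk l hl h1 h1' hkl
    rw [arcsCross_iff_not_iff] at h ⊢
    rwa [strictlyBetween_double_iff hd (by omega) hd' b1.1 b2.1 b3.1 n1 n4,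
      strictlyBetween_double_iff hd (by omega) (by omega) b1.1 b2.1 b4.1 n3 n2]

theorem doubleInto_bounds (hp : IsDoublingSeed r w j p) (hn : n % 2 = 1)
    (ha : IsOpenMeandricPerm n a) {t : ℕ} (h1 : 1 ≤ t) (ht : t ≤ r + 2 * n - 2) :
    1 ≤ doubleInto r w j n p a t ∧ doubleInto r w j n p a t ≤ r + 2 * n - 2 ∧
      doubleInto r w j n p a t % 2 = t % 2 := by
  obtain ⟨-, hb, -⟩ := isOpenMeandricPerm_iff.1 ha
  have h4 := hp.four_le
  have hjr := hp.j_le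
  have hje := hp.j_even
  have hwe := hp.w_even
  have hw := hp.w_add_two_le
  rcases hp.index_cases (n := n) (by omega) h1 ht with ⟨-, h⟩ | ⟨k, hk1, hk, rfl⟩ |
    ⟨s, hs1, hs, hsj, rfl⟩
  · rw [doubleInto_left h1 h (by omega)]
    have := hb t h h1
    omega
  · rw [hp.doubleInto_right hk1 hk]
    have := hb k hk hk1
    omega
  · rw [hp.doubleInto_oldIndex (by omega) hs1 hs hsj 0]
    have := hp.old_value hs1 hs hsj
    unfold seedEmb oldIndex
    split_ifs <;> omega

theorem doubleInto_injective (hp : IsDoublingSeed r w j p) (hn : n % 2 = 1)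
    (ha : IsOpenMeandricPerm n a) {t u : ℕ} (h1 : 1 ≤ t) (ht : t ≤ r + 2 * n - 2) (h1' : 1 ≤ u)
    (hu : u ≤ r + 2 * n - 2) (h : doubleInto r w j n p a t = doubleInto r w j n p a u) :
    t = u := by
  obtain ⟨-, hb, hi, -⟩ := isOpenMeandricPerm_iff.1 ha
  obtain ⟨-, -, hpi, -⟩ := isOpenMeandricPerm_iff.1 hp.perm
  have h4 := hp.four_le
  have hjr := hp.j_le
  have hje := hp.j_even
  have copy_ne : ∀ k d s, 1 ≤ k → k ≤ n → d ≤ 1 → 1 < s → s ≤ r → s ≠ j →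
      w + 2 * a k - d ≠ seedEmb w n 0 (p s) := by
    intro k d s hk1 hk hd hs1 hs hsj
    have := hp.old_value hs1 hs hsj
    have := hb k hk hk1
    unfold seedEmb
    split_ifs <;> omega
  rcases hp.index_cases (n := n) (by omega) h1 ht with ⟨-, c⟩ | ⟨k, hk1, hk, rfl⟩ |
      ⟨s, hs1, hs, hsj, rfl⟩ <;>
    rcases hp.index_cases (n := n) (by omega) h1' hu with ⟨-, c'⟩ | ⟨k', hk1', hk', rfl⟩ |
      ⟨s', hs1', hs', hsj', rfl⟩
  · rw [doubleInto_left h1 c (by omega), doubleInto_left h1' c' (by omega)] at h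
    have := hb t c h1
    have := hb u c' h1'
    exact hi t c u c' h1 h1' (by omega)
  · rw [doubleInto_left h1 c (by omega), hp.doubleInto_right hk1' hk'] at h
    have := hb t c h1
    have := hb k' hk' hk1'
    have := hi t c k' hk' h1 hk1' (by omega)
    omega
  · rw [doubleInto_left h1 c (by omega), hp.doubleInto_oldIndex (by omega) hs1' hs' hsj' 0] at h
    exact absurd h (copy_ne _ _ _ h1 c (by omega) hs1' hs' hsj')
  · rw [doubleInto_left h1' c' (by omega), hp.doubleInto_right hk1 hk] at h
    have := hb u c' h1'
    have := hb k hk hk1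
    have := hi u c' k hk h1' hk1 (by omega)
    omega
  · rw [hp.doubleInto_right hk1 hk, hp.doubleInto_right hk1' hk'] at h
    have := hb k hk hk1
    have := hb k' hk' hk1'
    have := hi k hk k' hk' hk1 hk1' (by omega)
    omega
  · rw [hp.doubleInto_right hk1 hk, hp.doubleInto_oldIndex (by omega) hs1' hs' hsj' 0] at h
    exact absurd h (copy_ne _ _ _ hk1 hk (by omega) hs1' hs' hsj')
  · rw [doubleInto_left h1' c' (by omega), hp.doubleInto_oldIndex (by omega) hs1 hs hsj 0] at h
    exact absurd h.symm (copy_ne _ _ _ h1' c' (by omega) hs1 hs hsj)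
  · rw [hp.doubleInto_right hk1' hk', hp.doubleInto_oldIndex (by omega) hs1 hs hsj 0] at h
    exact absurd h.symm (copy_ne _ _ _ hk1' hk' (by omega) hs1 hs hsj)
  · rw [hp.doubleInto_oldIndex (by omega) hs1 hs hsj 1,
      hp.doubleInto_oldIndex (by omega) hs1' hs' hsj' 1] at h
    have := (seedEmb_strictMono le_rfl (by omega)).injective h
    rw [hpi s hs s' hs' (by omega) (by omega) this]

theorem isOpenMeandricPerm_doubleInto (hp : IsDoublingSeed r w j p) (hn : n % 2 = 1)
    (ha : IsOpenMeandricPerm n a) :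
    IsOpenMeandricPerm (r + 2 * n - 2) (doubleInto r w j n p a) := by
  have h4 := hp.four_le
  have hjr := hp.j_le
  obtain ⟨-, hb, -⟩ := isOpenMeandricPerm_iff.1 ha
  obtain ⟨-, -, -, hpc, hps, hpe⟩ := isOpenMeandricPerm_iff.1 hp.perm
  have hb' : ∀ t ≤ n, 1 ≤ t → 1 ≤ a t := fun t ht h1 => (hb t ht h1).1
  have mono : ∀ t, StrictMono (seedEmb w n (endValue n a t)) := fun t =>
    seedEmb_strictMono (endValue_mem hn ha t).1 (endValue_mem hn ha t).2
  have endValue_congr : ∀ {s t}, s % 2 = t % 2 → endValue n a s = endValue n a t := by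
    intro s t h
    unfold endValue
    rw [h]
  have side : ∀ t < r + 2 * n - 2, 1 ≤ t → ∀ u x, t % 2 = u % 2 →
      (∀ s < r, 1 ≤ s → s % 2 = t % 2 → ¬ StrictlyBetween (p s) (p (s + 1)) x) →
      ¬ StrictlyBetween (doubleInto r w j n p a t) (doubleInto r w j n p a (t + 1))
        (seedEmb w n (endValue n a u) x) := by
    intro t ht h1 u x htu hx
    rcases hp.arc_cases hn hb' h1 ht with ⟨s, hs, hs1, hst, e1, e2⟩ |
      ⟨k, hk, d, hd, hk1, hkt, e⟩
    · rw [e1, e2, endValue_congr htu, (mono u).strictlyBetween_iff]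
      exact hx s hs hs1 hst
    · have := copy_arc_sep (w := w) hn ha hk hk1 hd (hkt.trans htu) x
      unfold StrictlyBetween
      omega
  refine isOpenMeandricPerm_iff.2 ⟨by omega, fun t ht h1 => hp.doubleInto_bounds hn ha h1 ht,
    fun s hs t ht h1 h1' => hp.doubleInto_injective hn ha h1 hs h1' ht, ?_, ?_, ?_⟩
  · intro t ht u hu h1 h1' htu
    rcases hp.arc_cases hn hb' h1 ht with ⟨s, hs, hs1, hst, e1, e2⟩ |
        ⟨k, hk, d, hd, hk1, hkt, e⟩ <;>
      rcases hp.arc_cases hn hb' h1' hu with ⟨s', hs', hs1', hst', e1', e2'⟩ |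
        ⟨k', hk', d', hd', hk1', hkt', e'⟩
    · rw [e1, e2, e1', e2', endValue_congr htu, (mono u).arcsCross_iff]
      exact hpc s hs s' hs' hs1 hs1' (by omega)
    · have g1 := copy_arc_sep (w := w) hn ha hk' hk1' hd' (hkt'.trans htu.symm) (p s)
      have g2 := copy_arc_sep (w := w) hn ha hk' hk1' hd' (hkt'.trans htu.symm) (p (s + 1))
      rw [arcsCross_iff_not_iff]
      unfold StrictlyBetween
      omega
    · have g1 := copy_arc_sep (w := w) hn ha hk hk1 hd (hkt.trans htu) (p s')
      have g2 := copy_arc_sep (w := w) hn ha hk hk1 hd (hkt.trans htu) (p (s' + 1))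
      rw [arcsCross_iff_not_iff]
      unfold StrictlyBetween
      omega
    · have g := copy_arcs_not_cross (w := w) ha hk hk' hk1 hk1' hd hd' (by omega)
      rcases e with ⟨e1, e2⟩ | ⟨e1, e2⟩ <;> rcases e' with ⟨e1', e2'⟩ | ⟨e1', e2'⟩ <;>
        rw [e1, e2, e1', e2']
      · exact g
      · rwa [arcsCross_swap_right]
      · rwa [arcsCross_swap_left]
      · rwa [arcsCross_swap_left, arcsCross_swap_right]
  · intro t ht h1 h0
    rw [hp.doubleInto_first (by omega) (hb' 1 (by omega) le_rfl)]
    exact side t ht h1 0 (p 1) h0 fun s hs hs1 hst => hps s hs hs1 (by omega)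
  · intro t ht h1 h0
    rw [hp.doubleInto_last hn (hb' 1 (by omega) le_rfl)]
    exact side t ht h1 r (p r) (by omega) fun s hs hs1 hst => hpe s hs hs1 (by omega)

theorem isIrreducibleMeander_doubleInto (hp : IsDoublingSeed r w j p) (hn : n % 2 = 1)
    (hn3 : 3 ≤ n) (ha : IsOpenMeandricPerm n a) :
    IsIrreducibleMeander (r + 2 * n - 2) (doubleInto r w j n p a) := by
  refine isIrreducibleMeander_of_not_convex (hp.isOpenMeandricPerm_doubleInto hn ha) ?_
  intro k₁ k₂ h1 h2 hlo hhi H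
  have h4 := hp.four_le
  have hjr := hp.j_le
  obtain ⟨-, hb, hi, -⟩ := isOpenMeandricPerm_iff.1 ha
  have left : ∀ k, 1 ≤ k → k ≤ n → doubleInto r w j n p a k = w + 2 * a k - k % 2 :=
    fun k hk1 hk => doubleInto_left hk1 hk (by omega)
  have right : ∀ k, 1 ≤ k → k ≤ n →
      doubleInto r w j n p a (2 * n + j - 1 - k) = w + 2 * a k - (k + 1) % 2 :=
    fun k hk1 hk => hp.doubleInto_right hk1 hk
  have old : ∀ s, 1 < s → s ≤ r → s ≠ j →
      doubleInto r w j n p a (oldIndex j n s) = seedEmb w n 1 (p s) :=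
    fun s hs1 hs hsj => hp.doubleInto_oldIndex (by omega) hs1 hs hsj 1
  have hn1 : 1 ≤ n := by omega
  have hw2 := hp.w_add_two_le
  set σ := doubleInto r w j n p a
  have oldval : ∀ s, 1 < s → s ≤ r → s ≠ j →
      σ (oldIndex j n s) ≤ w ∨ w + 2 * n < σ (oldIndex j n s) := by
    intro s hs1 hs hsj
    rw [old s hs1 hs hsj]
    have := hp.old_value hs1 hs hsj
    unfold seedEmb
    split_ifs <;> omega
  have seg : ∀ l₁ l₂, 2 ≤ l₁ → l₁ + 2 ≤ l₂ → l₂ ≤ r →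
      (∀ s, l₁ ≤ s → s ≤ l₂ → s ≠ j ∧ k₁ ≤ oldIndex j n s ∧ oldIndex j n s ≤ k₂) →
      (∀ s, 1 < s → s ≤ r → s ≠ j → (s < l₁ ∨ l₂ < s) →
        oldIndex j n s < k₁ ∨ k₂ < oldIndex j n s) →
      (∃ x, 1 ≤ x ∧ x ≤ r + 2 * n - 2 ∧ (x < k₁ ∨ k₂ < x) ∧ w < σ x ∧ σ x ≤ w + 2 * n) →
      False := by
    rintro l₁ l₂ hl1 hl hl2 hin hout ⟨x, hx1, hx, hxo, hxw, hxw'⟩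
    obtain ⟨s, hs, hs1, hso, ⟨t, ht, ht1, hts⟩, u, hu, hu1, hsu⟩ :=
      hp.simple l₁ (by omega) l₂ hl2 (by omega) hl (by omega)
    obtain ⟨tj, ti, ti'⟩ := hin t ht1 ht
    obtain ⟨uj, ui, ui'⟩ := hin u hu1 hu
    have tv := hp.old_value (by omega) (by omega) tj
    have uv := hp.old_value (by omega) (by omega) uj
    have te := old t (by omega) (by omega) tj
    have ue := old u (by omega) (by omega) uj
    by_cases c : s = 1 ∨ s = j
    · have hps : p s = w + 1 ∨ p s = w + 2 := by
        rcases c with rfl | rfl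
        · exact Or.inl hp.first
        · exact Or.inr hp.second
      refine H x _ _ hx1 hx hxo ti ti' ui ui' ?_
      rw [te, ue]
      unfold seedEmb
      split_ifs <;> omega
    · have hio := hout s (by omega) hs (by omega) hso
      refine H _ _ _ ?_ ?_ hio ti ti' ui ui' ?_
      · unfold oldIndex; split_ifs <;> omega
      · unfold oldIndex; split_ifs <;> omega
      · rw [te, ue, old s (by omega) hs (by omega)]
        exact ⟨seedEmb_strictMono le_rfl hn1 hts, seedEmb_strictMono le_rfl hn1 hsu⟩
  have copy : ∀ f g δ : ℕ → ℕ,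
      (∀ k, 1 ≤ k → k ≤ n → δ k ≤ 1 ∧ σ (f k) = w + 2 * a k - δ k ∧
        σ (g k) = w + 2 * a k - (1 - δ k) ∧ 1 ≤ g k ∧ g k ≤ r + 2 * n - 2 ∧
        (g k < k₁ ∨ k₂ < g k)) →
      ∀ x y, 1 ≤ x → x ≤ n → 1 ≤ y → y ≤ n → x ≠ y → k₁ ≤ f x → f x ≤ k₂ → k₁ ≤ f y →
      f y ≤ k₂ → ∀ z, k₁ ≤ z → z ≤ k₂ → (σ z ≤ w ∨ w + 2 * n < σ z ∨
        ∃ v, 1 ≤ v ∧ v ≤ n ∧ v ≠ x ∧ v ≠ y ∧ z = f v) → False := by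
    intro f g δ hfg x y hx1 hx hy1 hy hxy fx1 fx fy1 fy z hz1 hz hcase
    have tri : ∀ x y z, 1 ≤ x → x ≤ n → 1 ≤ y → y ≤ n → 1 ≤ z → z ≤ n → k₁ ≤ f x → f x ≤ k₂ →
        k₁ ≤ f z → f z ≤ k₂ → ¬ (a x < a y ∧ a y < a z) := by
      intro x y z hx1 hx hy1 hy hz1 hz fx1 fx fz1 fz ⟨hxy, hyz⟩
      obtain ⟨dx, ex, -⟩ := hfg x hx1 hx
      obtain ⟨dy, -, ey, gy1, gy, gyo⟩ := hfg y hy1 hy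
      obtain ⟨dz, ez, -⟩ := hfg z hz1 hz
      refine H (g y) (f x) (f z) gy1 gy gyo fx1 fx fz1 fz ?_
      omega
    have two : ∀ x y, 1 ≤ x → x ≤ n → 1 ≤ y → y ≤ n → k₁ ≤ f x → f x ≤ k₂ →
        k₁ ≤ f y → f y ≤ k₂ → a x < a y → (σ z ≤ w ∨ w + 2 * n < σ z) → False := by
      intro x y hx1 hx hy1 hy fx1 fx fy1 fy hxy hzw
      have bx := hb x hx hx1
      have by' := hb y hy hy1
      obtain ⟨dx, ex, ex', gx1, gx, gxo⟩ := hfg x hx1 hx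
      obtain ⟨dy, ey, ey', gy1, gy, gyo⟩ := hfg y hy1 hy
      rcases hzw with h | h
      · refine H (g x) z (f y) gx1 gx gxo hz1 hz fy1 fy ?_
        omega
      · refine H (g y) (f x) z gy1 gy gyo fx1 fx hz1 hz ?_
        omega
    have hne : a x ≠ a y := fun h => hxy (hi x hx y hy hx1 hy1 h)
    have htwo : (σ z ≤ w ∨ w + 2 * n < σ z) → False := fun h => by
      rcases lt_or_gt_of_ne hne with h' | h'
      · exact two x y hx1 hx hy1 hy fx1 fx fy1 fy h' h
      · exact two y x hy1 hy hx1 hx fy1 fy fx1 fx h' h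
    rcases hcase with h | h | ⟨v, hv1, hv, hvx, hvy, rfl⟩
    · exact htwo (Or.inl h)
    · exact htwo (Or.inr h)
    · have n1 : a v ≠ a x := fun h => hvx (hi v hv x hx hv1 hx1 h)
      have n2 : a v ≠ a y := fun h => hvy (hi v hv y hy hv1 hy1 h)
      have t1 := tri x y v hx1 hx hy1 hy hv1 hv fx1 fx hz1 hz
      have t2 := tri x v y hx1 hx hv1 hv hy1 hy fx1 fx fy1 fy
      have t3 := tri y x v hy1 hy hx1 hx hv1 hv fy1 fy hz1 hz
      have t4 := tri y v x hy1 hy hv1 hv hx1 hx fy1 fy fx1 fx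
      have t5 := tri v x y hv1 hv hx1 hx hy1 hy hz1 hz fy1 fy
      have t6 := tri v y x hv1 hv hy1 hy hx1 hx hz1 hz fx1 fx
      omega
  have hleft : ∀ k, 1 ≤ k → k ≤ n → w < σ k ∧ σ k ≤ w + 2 * n := by
    intro k hk1 hk
    rw [left k hk1 hk]
    have := hb k hk hk1
    omega
  have hright : ∀ k, 1 ≤ k → k ≤ n →
      w < σ (2 * n + j - 1 - k) ∧ σ (2 * n + j - 1 - k) ≤ w + 2 * n := by
    intro k hk1 hk
    rw [right k hk1 hk]
    have := hb k hk hk1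
    omega
  have hmidIndex : ∀ s, s < j → oldIndex j n s = s + n - 1 := fun s h => if_pos h
  have htailIndex : ∀ s, ¬ s < j → oldIndex j n s = s + 2 * n - 2 := fun s h => if_neg h
  have hindex : ∀ s, (s < j ∧ oldIndex j n s = s + n - 1) ∨
      (¬ s < j ∧ oldIndex j n s = s + 2 * n - 2) := fun s => by
    by_cases h : s < j
    · exact Or.inl ⟨h, hmidIndex s h⟩
    · exact Or.inr ⟨h, htailIndex s h⟩
  by_cases cB : k₁ ≤ n
  · by_cases cC : n + j - 1 ≤ k₂
    · obtain ⟨sl, hslj, hsl1, hsl⟩ := hp.low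
      obtain ⟨sh, hshj, hsh1, hsh⟩ := hp.high
      have el := old sl hsl1 (by omega) (by omega)
      have eh := old sh hsh1 (by omega) (by omega)
      rw [hmidIndex sl hslj, seedEmb, if_pos hsl] at el
      rw [hmidIndex sh hshj, seedEmb, if_neg (by omega), if_neg (by omega)] at eh
      have hk1 : k₁ = 1 := by
        by_contra hk
        have h := hleft 1 le_rfl hn1
        refine H 1 (sl + n - 1) (sh + n - 1) le_rfl (by omega) (by omega) (by omega) (by omega)
          (by omega) (by omega) ?_
        omega
      have hk2 : 2 * n + j - 1 - 1 ≤ k₂ := by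
        by_contra hk
        have h := hright 1 le_rfl hn1
        refine H (2 * n + j - 1 - 1) (sl + n - 1) (sh + n - 1) (by omega) (by omega) (by omega)
          (by omega) (by omega) (by omega) (by omega) ?_
        omega
      obtain ⟨s, hs, hs1, hso, ⟨t, ht, ht1, hts⟩, u, hu, hu1, hsu⟩ :=
        hp.simple 1 (by omega) (k₂ + 2 - 2 * n) (by omega) le_rfl (by omega) (by omega)
      have hb1 := hb 1 hn1 le_rfl
      have mem : ∀ t, 1 ≤ t → t ≤ k₂ + 2 - 2 * n →
          ∃ i, k₁ ≤ i ∧ i ≤ k₂ ∧ σ i = seedEmb w n (a 1) (p t) := by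
        intro t ht1 ht
        by_cases t1 : t = 1
        · subst t1
          exact ⟨1, by omega, by omega, hp.doubleInto_first hn1 hb1.1⟩
        by_cases tj : t = j
        · refine ⟨2 * n + j - 1 - 1, by omega, by omega, ?_⟩
          rw [right 1 le_rfl hn1, tj, hp.second, seedEmb, if_neg (by omega), if_pos (by omega)]
          omega
        · refine ⟨oldIndex j n t, ?_, ?_, hp.doubleInto_oldIndex hn1 (by omega) (by omega) tj _⟩
          · have := hindex t
            omega
          · have := hindex t
            omega
      obtain ⟨i, hi1, hi2, ei⟩ := mem t ht1 ht
      obtain ⟨i', hi1', hi2', ei'⟩ := mem u hu1 hu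
      have his := htailIndex s (by omega)
      refine H (oldIndex j n s) i i' (by omega) (by omega) (by omega) hi1 hi2 hi1' hi2' ?_
      have es : σ (oldIndex j n s) = seedEmb w n (a 1) (p s) :=
        hp.doubleInto_oldIndex hn1 (by omega) hs (by omega) _
      rw [ei, ei', es]
      exact ⟨seedEmb_strictMono hb1.1 hb1.2.1 hts, seedEmb_strictMono hb1.1 hb1.2.1 hsu⟩
    · by_cases c1 : k₁ = n
      · refine seg 2 (k₂ + 1 - n) le_rfl (by omega) (by omega) ?_ ?_
          ⟨2 * n + j - 1 - 1, by omega, by omega, by omega, hright 1 le_rfl hn1⟩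
        · intro s h h'
          have := hindex s
          omega
        · intro s h h' h'' h3
          have := hindex s
          omega
      · refine copy (fun k => k) (fun k => 2 * n + j - 1 - k) (fun k => k % 2) ?_ k₁ (k₁ + 1)
          (by omega) (by omega) (by omega) (by omega) (by omega) (by omega) (by omega) (by omega)
          (by omega) (if k₁ + 1 = n then n + 1 else k₁ + 2) (by split_ifs <;> omega)
          (by split_ifs <;> omega) ?_
        · intro k hk1 hk
          refine ⟨by omega, left k hk1 hk, ?_, by omega, by omega, by omega⟩
          rw [right k hk1 hk]
          omega
        · split_ifs with c2
          · have h := oldval 2 (by omega) (by omega) (by omega)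
            rw [hmidIndex 2 (by omega), show 2 + n - 1 = n + 1 by omega] at h
            omega
          · exact Or.inr (Or.inr ⟨k₁ + 2, by omega, by omega, by omega, by omega, rfl⟩)
  have out1 : ∃ x, 1 ≤ x ∧ x ≤ r + 2 * n - 2 ∧ (x < k₁ ∨ k₂ < x) ∧ w < σ x ∧ σ x ≤ w + 2 * n :=
    ⟨1, le_rfl, by omega, by omega, hleft 1 le_rfl hn1⟩
  by_cases cM : k₂ < n + j
  · refine seg (k₁ + 1 - n) (if k₂ + 1 = n + j then j - 1 else k₂ + 1 - n) (by omega) ?_ ?_ ?_ ?_ out1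
    · split_ifs <;> omega
    · split_ifs <;> omega
    · intro s h h'
      have := hindex s
      split_ifs at h' <;> omega
    · intro s h h' h'' h3
      have := hindex s
      split_ifs at h3 <;> omega
  by_cases cT : 2 * n + j - 2 ≤ k₁
  · refine seg (if k₁ + 2 = 2 * n + j then j + 1 else k₁ + 2 - 2 * n) (k₂ + 2 - 2 * n)
      ?_ ?_ (by omega) ?_ ?_ out1
    · split_ifs <;> omega
    · split_ifs <;> omega
    · intro s h h'
      have := hindex s
      split_ifs at h <;> omega
    · intro s h h' h'' h3
      have := hindex s
      split_ifs at h3 <;> omega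
  have third : ∃ i, n + j - 1 ≤ i ∧ i + 1 ≤ 2 * n + j - 2 ∧ k₁ ≤ i ∧ i + 1 ≤ k₂ ∧
      ∃ z, k₁ ≤ z ∧ z ≤ k₂ ∧ (z = i + 2 ∧ z ≤ 2 * n + j - 2 ∨ z = n + j - 2 ∨
        z = 2 * n + j - 1) := by
    by_cases d1 : k₁ ≤ n + j - 2
    · exact ⟨n + j - 1, by omega, by omega, by omega, by omega, n + j - 2, by omega, by omega,
        Or.inr (Or.inl rfl)⟩
    · by_cases d2 : k₁ + 2 ≤ 2 * n + j - 2
      · exact ⟨k₁, by omega, by omega, by omega, by omega, k₁ + 2, by omega, by omega,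
          Or.inl ⟨rfl, d2⟩⟩
      · exact ⟨k₁, by omega, by omega, by omega, by omega, 2 * n + j - 1, by omega, by omega,
          Or.inr (Or.inr rfl)⟩
  obtain ⟨i, hi1, hi2, hi3, hi4, z, hz1, hz2, hz⟩ := third
  refine copy (fun k => 2 * n + j - 1 - k) (fun k => k) (fun k => (k + 1) % 2) ?_
    (2 * n + j - 1 - i) (2 * n + j - 2 - i) (by omega) (by omega) (by omega) (by omega) (by omega)
    (by omega) (by omega) (by omega) (by omega) z hz1 hz2 ?_
  · intro k hk1 hk
    refine ⟨by omega, right k hk1 hk, ?_, by omega, by omega, by omega⟩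
    rw [left k hk1 hk]
    omega
  · rcases hz with ⟨rfl, hz⟩ | rfl | rfl
    · exact Or.inr (Or.inr ⟨2 * n + j - 3 - i, by omega, by omega, by omega, by omega, by omega⟩)
    · have h := oldval (j - 1) (by omega) (by omega) (by omega)
      rw [hmidIndex (j - 1) (by omega), show j - 1 + n - 1 = n + j - 2 by omega] at h
      omega
    · have h := oldval (j + 1) (by omega) (by omega) (by omega)
      rw [htailIndex (j + 1) (by omega), show j + 1 + 2 * n - 2 = 2 * n + j - 1 by omega] at h
      omega

end IsDoublingSeed

theorem finite_setOf_isOpenMeandricPerm (n : ℕ) :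
    {a : ℕ → ℕ | IsOpenMeandricPerm n a ∧ ∀ i, i < 1 ∨ n < i → a i = 0}.Finite := by
  refine Set.Finite.of_finite_image (f := fun (a : ℕ → ℕ) (i : Fin (n + 1)) => a i)
    (Set.Finite.subset (Set.Finite.pi' fun _ : Fin (n + 1) => Set.finite_Iic n) ?_) ?_
  · rintro _ ⟨a, ⟨ha, h0⟩, rfl⟩ i
    obtain ⟨-, hb, -⟩ := isOpenMeandricPerm_iff.1 ha
    by_cases hi : (i : ℕ) = 0
    · simp [h0 i (Or.inl (by omega))]
    · exact (hb i (by omega) (by omega)).2.1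
  · rintro a ⟨-, ha⟩ b ⟨-, hb⟩ hab
    funext i
    by_cases hi : n < i
    · rw [ha i (Or.inr hi), hb i (Or.inr hi)]
    · exact congrFun hab ⟨i, by omega⟩

theorem irrMeanderCount_le_openMeanderCount (n : ℕ) :
    irrMeanderCount n ≤ openMeanderCount n :=
  Set.ncard_le_ncard (fun _ ha => ⟨ha.1, ha.2.2⟩) (finite_setOf_isOpenMeandricPerm n)

theorem IsDoublingSeed.openMeanderCount_le {r w j n : ℕ} {p : ℕ → ℕ}
    (hp : IsDoublingSeed r w j p) (hn : n % 2 = 1) (hn3 : 3 ≤ n) :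
    openMeanderCount n ≤ irrMeanderCount (r + 2 * n - 2) := by
  have h4 := hp.four_le
  have hjr := hp.j_le
  refine Set.ncard_le_ncard_of_injOn (doubleInto r w j n p) ?_ ?_ ?_
  · rintro a ⟨ha, -⟩
    refine ⟨hp.isOpenMeandricPerm_doubleInto hn ha,
      hp.isIrreducibleMeander_doubleInto hn hn3 ha, fun i hi => ?_⟩
    unfold doubleInto
    rw [if_pos (by omega)]
  · rintro a ⟨ha, ha0⟩ b ⟨hb, hb0⟩ hab
    funext i
    by_cases hi : i < 1 ∨ n < i
    · rw [ha0 i hi, hb0 i hi]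
    · have h := congrFun hab i
      rw [doubleInto_left (by omega) (by omega) (by omega),
        doubleInto_left (by omega) (by omega) (by omega)] at h
      have h1 := (isOpenMeandricPerm_iff.1 ha).2.1 i (by omega) (by omega)
      have h2 := (isOpenMeandricPerm_iff.1 hb).2.1 i (by omega) (by omega)
      omega
  · exact (finite_setOf_isOpenMeandricPerm _).subset fun _ ha => ⟨ha.1, ha.2.2⟩

instance decidableStrictlyBetween (p q x : ℕ) : Decidable (StrictlyBetween p q x) := by
  unfold StrictlyBetween; infer_instance

instance decidableArcsCross (p q r s : ℕ) : Decidable (ArcsCross p q r s) :=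
  decidable_of_iff' _ arcsCross_iff_not_iff

set_option synthInstance.maxSize 4000 in
instance decidableIsOpenMeandricPerm (n : ℕ) (a : ℕ → ℕ) : Decidable (IsOpenMeandricPerm n a) :=
  decidable_of_iff' _ isOpenMeandricPerm_iff

set_option synthInstance.maxSize 4000 in
theorem isDoublingSeed_eight :
    IsDoublingSeed 8 2 8 fun i => [0, 3, 6, 7, 2, 1, 8, 5, 4].getD i 0 where
  perm := by decide +kernel
  w_even := rfl
  j_even := rfl
  j_le := by decide
  first := rfl
  second := rfl
  low := by decide +kernel
  high := by decide +kernel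
  simple := by decide +kernel

set_option synthInstance.maxSize 4000 in
theorem isDoublingSeed_thirteen :
    IsDoublingSeed 13 2 10 fun i => [0, 3, 6, 7, 2, 1, 8, 11, 12, 5, 4, 13, 10, 9].getD i 0 where
  perm := by decide +kernel
  w_even := rfl
  j_even := rfl
  j_le := by decide
  first := rfl
  second := rfl
  low := by decide +kernel
  high := by decide +kernel
  simple := by decide +kernel

set_option synthInstance.maxSize 4000 in
theorem isDoublingSeed_fourteen :
    IsDoublingSeed 14 2 12
      fun i => [0, 3, 6, 7, 2, 1, 8, 9, 14, 13, 10, 5, 4, 11, 12].getD i 0 where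
  perm := by decide +kernel
  w_even := rfl
  j_even := rfl
  j_le := by decide
  first := rfl
  second := rfl
  low := by decide +kernel
  high := by decide +kernel
  simple := by decide +kernel

set_option synthInstance.maxSize 4000 in
theorem isDoublingSeed_fifteen :
    IsDoublingSeed 15 2 12
      fun i => [0, 3, 6, 7, 2, 1, 10, 13, 14, 9, 8, 5, 4, 15, 12, 11].getD i 0 where
  perm := by decide +kernel
  w_even := rfl
  j_even := rfl
  j_le := by decide
  first := rfl
  second := rfl
  low := by decide +kernel
  high := by decide +kernel
  simple := by decide +kernel

theorem exists_openMeanderCount_le_irrMeanderCount {N : ℕ} (hN : 20 ≤ N) :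
    ∃ n, 2 * n ≤ N ∧ N ≤ 2 * n + 13 ∧ openMeanderCount n ≤ irrMeanderCount N := by
  have seed : ∀ {r w j : ℕ} {p : ℕ → ℕ}, IsDoublingSeed r w j p → 8 ≤ r → r ≤ 15 →
      (N + 2 - r) % 4 = 2 →
      ∃ n, 2 * n ≤ N ∧ N ≤ 2 * n + 13 ∧ openMeanderCount n ≤ irrMeanderCount N := by
    intro r w j p hp h8 h15 hr
    refine ⟨(N + 2 - r) / 2, by omega, by omega, ?_⟩
    have := hp.openMeanderCount_le (n := (N + 2 - r) / 2) (by omega) (by omega)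
    rwa [show r + 2 * ((N + 2 - r) / 2) - 2 = N by omega] at this
  have : N % 4 = 0 ∨ N % 4 = 1 ∨ N % 4 = 2 ∨ N % 4 = 3 := by omega
  rcases this with h | h | h | h
  · exact seed isDoublingSeed_eight le_rfl (by omega) (by omega)
  · exact seed isDoublingSeed_thirteen (by omega) (by omega) (by omega)
  · exact seed isDoublingSeed_fourteen (by omega) (by omega) (by omega)
  · exact seed isDoublingSeed_fifteen (by omega) le_rfl (by omega)

/-- If `L = lim (M n)^(1/n)` exists, then
`liminf (M^{Irr} n)^(1/n) ≥ √L`. -/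
theorem irr_meander_growth_lower_bound (L : ℝ)
    (hL : Tendsto (fun n : ℕ => (openMeanderCount n : ℝ) ^ (1 / (n : ℝ))) atTop (nhds L)) :
    liminf (fun n : ℕ => (irrMeanderCount n : ℝ) ^ (1 / (n : ℝ))) atTop ≥
      Real.sqrt L := by
  have hex : ∀ N : ℕ, ∃ n, 20 ≤ N →
      2 * n ≤ N ∧ N ≤ 2 * n + 13 ∧ openMeanderCount n ≤ irrMeanderCount N := fun N => by
    by_cases hN : 20 ≤ N
    · obtain ⟨n, hn⟩ := exists_openMeanderCount_le_irrMeanderCount hN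
      exact ⟨n, fun _ => hn⟩
    · exact ⟨0, fun h => absurd h hN⟩
  choose m hm using hex
  have hm_top : Tendsto m atTop atTop := by
    refine tendsto_atTop.2 fun b => ?_
    filter_upwards [eventually_ge_atTop (2 * b + 20)] with N hN
    have := hm N (by omega)
    omega
  have hratio : Tendsto (fun N : ℕ => (m N : ℝ) / N) atTop (nhds (1 / 2)) := by
    have hlow : Tendsto (fun N : ℕ => (1 / 2 : ℝ) - (13 / 2) / N) atTop (nhds (1 / 2)) := by
      simpa using (tendsto_const_div_atTop_nhds_zero_nat (13 / 2 : ℝ)).const_sub (1 / 2 : ℝ)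
    refine tendsto_of_tendsto_of_tendsto_of_le_of_le' hlow tendsto_const_nhds ?_ ?_
    · filter_upwards [eventually_ge_atTop 20] with N hN
      have hN0 : (0 : ℝ) < N := by exact_mod_cast (by omega : 0 < N)
      have h : (N : ℝ) ≤ 2 * m N + 13 := by exact_mod_cast (hm N hN).2.1
      rw [le_div_iff₀ hN0, sub_mul, div_mul_cancel₀ _ hN0.ne']
      linarith
    · filter_upwards [eventually_ge_atTop 20] with N hN
      have hN0 : (0 : ℝ) < N := by exact_mod_cast (by omega : 0 < N)
      have h : 2 * (m N : ℝ) ≤ N := by exact_mod_cast (hm N hN).1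
      rw [div_le_iff₀ hN0]
      linarith
  have hlim : Tendsto (fun N : ℕ => (openMeanderCount (m N) : ℝ) ^ (1 / (N : ℝ))) atTop
      (nhds (Real.sqrt L)) := by
    rw [Real.sqrt_eq_rpow]
    refine ((hL.comp hm_top).rpow hratio (Or.inr (by norm_num))).congr' ?_
    filter_upwards [eventually_ge_atTop 20] with N hN
    have hm0 : (m N : ℝ) ≠ 0 := by
      have := hm N hN
      exact_mod_cast (by omega : m N ≠ 0)
    simp only [Function.comp_apply]
    rw [← Real.rpow_mul (Nat.cast_nonneg _)]
    congr 1
    field_simp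
  have hbdd : IsBoundedUnder (· ≤ ·) atTop
      fun n : ℕ => (irrMeanderCount n : ℝ) ^ (1 / (n : ℝ)) := by
    refine hL.isBoundedUnder_le.mono_le (Eventually.of_forall fun n => ?_)
    exact Real.rpow_le_rpow (Nat.cast_nonneg _)
      (by exact_mod_cast irrMeanderCount_le_openMeanderCount n) (by positivity)
  rw [ge_iff_le, ← hlim.liminf_eq]
  refine liminf_le_liminf ?_ hlim.isBoundedUnder_ge hbdd.isCoboundedUnder_ge
  filter_upwards [eventually_ge_atTop 20] with N hN
  exact Real.rpow_le_rpow (Nat.cast_nonneg _) (by exact_mod_cast (hm N hN).2.2) (by positivity)
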